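/- There exists α_0 > 0 such that for every 0 < α ≤ α_0 there exists ε_0 > 0 such that for every 0 < ε ≤ ε_0 there exists n_0 such that for all n ≥ n_0 the following holds. For every 2-edge-coloured (1−ε, α)-dense 5-graph H on n vertices there exist a 2-edge-coloured 3-graph G with V(G) = V(H), disjoint sets V^red, V^blue ⊆ V(H), a red tight component R of H and a blue tight component B of H such that: (i) G is a 3√ε-blueprint for H and, viewed as a 3-graph on n vertices, G is (1 − α^{1/37}, α^{1/37})-dense; (ii) |V(H) ∖ (V^red ∪ V^blue)| ≤ α^{1/75}·n; (iii) every v ∈ V^red satisfies d_{∂(R³)}(v) ≥ (1 − α^{1/75})n, where R³ denotes the 3-graph of all edges e of G with H(e) = R and ∂(R³) its first shadow; and (iv) every v ∈ V^blue satisfies d_{∂(B³)}(v) ≥ (1 − α^{1/75})n, where B³ denotes the 3-graph of all edges e of G with H(e) = B and ∂(B³) its first shadow. -/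

import Mathlib

open Finset

/-- `degOn k H S W` is `d_H(S, W)`: the number of `(k - |S|)`-element subsets `e` of `W`
with `e ∪ S` an edge of the `k`-graph `H`. -/
def degOn {V : Type*} [DecidableEq V] (k : ℕ) (H : Finset (Finset V)) (S W : Finset V) : ℕ :=
  ((W.powersetCard (k - S.card)).filter (fun e => e ∪ S ∈ H)).card

/-- `degT k H S` is `d_H(S) = d_H(S, V)`. -/
def degT {V : Type*} [Fintype V] [DecidableEq V] (k : ℕ) (H : Finset (Finset V))
    (S : Finset V) : ℕ :=
  degOn k H S Finset.univ

/-- A `k`-graph `H` on the vertex set `V` is `(μ, α)`-dense. -/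
def IsDense {V : Type*} [Fintype V] [DecidableEq V] (k : ℕ) (H : Finset (Finset V))
    (μ α : ℝ) : Prop :=
  ∀ i : ℕ, 1 ≤ i → i ≤ k - 1 →
    (({S : Finset V | S.card = i ∧
        (degT k H S : ℝ) < μ * ((Fintype.card V).choose (k - i))}.ncard : ℝ)
      ≤ α * ((Fintype.card V).choose i)) ∧
    ∀ S : Finset V, S.card = i →
      (degT k H S : ℝ) < μ * ((Fintype.card V).choose (k - i)) → degT k H S = 0

/-- Two edges `f, f'` of a `k`-graph `Hc` are tightly connected: there is a walk of edges,
consecutive ones sharing `k - 1` vertices. -/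
def TightConn {V : Type*} [DecidableEq V] (k : ℕ) (Hc : Finset (Finset V)) (f f' : Finset V) : Prop :=
  ∃ (t : ℕ) (e : ℕ → Finset V), e 0 = f ∧ e t = f' ∧ (∀ i ≤ t, e i ∈ Hc) ∧
    ∀ i < t, ((e i) ∩ (e (i + 1))).card = k - 1

/-- `C` is a tightly connected subgraph of the `k`-graph `Hc`. -/
def IsTCSub {V : Type*} [DecidableEq V] (k : ℕ) (Hc C : Finset (Finset V)) : Prop :=
  C ⊆ Hc ∧ ∀ f ∈ C, ∀ f' ∈ C, TightConn k Hc f f'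

/-- `C` is a tight component (a maximal tightly connected subgraph) of the `k`-graph `Hc`. -/
def IsTightComponent {V : Type*} [DecidableEq V] (k : ℕ) (Hc C : Finset (Finset V)) : Prop :=
  IsTCSub k Hc C ∧ ∀ C' : Finset (Finset V), IsTCSub k Hc C' → C ⊆ C' → C' = C

/-- The shadow of `H` consisting of all `r`-element sets contained in some edge of `H`. -/
def shadowTo {V : Type*} [Fintype V] [DecidableEq V] (r : ℕ) (H : Finset (Finset V)) :
    Finset (Finset V) :=
  ((Finset.univ : Finset V).powersetCard r).filter (fun e => ∃ f ∈ H, e ⊆ f)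

/-- An `ε`-blueprint for a 2-edge-coloured `k`-graph `H` (with colouring `cH`, `true` = red):
a 2-edge-coloured `(k-2)`-graph together with the assignment `comp` of monochromatic tight
components, satisfying (BP1) and (BP2). -/
structure Blueprint (k : ℕ) {V : Type*} [Fintype V] [DecidableEq V]
    (H : Finset (Finset V)) (cH : Finset V → Bool) (ε : ℝ) where
  verts : Finset V
  edges : Finset (Finset V)
  col : Finset V → Bool
  comp : Finset V → Finset (Finset V)
  edges_card : ∀ e ∈ edges, e.card = k - 2
  edges_sub : ∀ e ∈ edges, e ⊆ verts
  comp_is : ∀ e ∈ edges, IsTightComponent k (H.filter (fun f => cH f = col e)) (comp e)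
  comp_deg : ∀ e ∈ edges,
    (1 - ε) * (Fintype.card V : ℝ) ≤ (degT (k - 1) (shadowTo (k - 1) (comp e)) e : ℝ)
  comp_agree : ∀ e ∈ edges, ∀ e' ∈ edges, col e = col e' → (e ∩ e').card = k - 3 →
    comp e = comp e'

/-- For a subset `G'` of the edges of a blueprint `G`, the `k`-graph `(G')⁺`: all edges of
`⋃_{e ∈ G'} H(e)` containing some edge of `G'`. -/
def Blueprint.plus {k : ℕ} {V : Type*} [Fintype V] [DecidableEq V]
    {H : Finset (Finset V)} {cH : Finset V → Bool} {ε : ℝ}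
    (G : Blueprint k H cH ε) (G' : Finset (Finset V)) : Finset (Finset V) :=
  (G'.biUnion (fun e => G.comp e)).filter (fun f => ∃ e ∈ G', e ⊆ f)

/-- `M` is a matching: a set of pairwise disjoint edges. -/
def IsMatching {V : Type*} [DecidableEq V] (M : Finset (Finset V)) : Prop :=
  ∀ e ∈ M, ∀ f ∈ M, e ≠ f → Disjoint e f

/-- `M` is a tightly connected matching in the `k`-graph `Hc`. -/
def IsTCMatching {V : Type*} [DecidableEq V] (k : ℕ) (Hc M : Finset (Finset V)) : Prop :=
  M ⊆ Hc ∧ IsMatching M ∧ ∀ e ∈ M, ∀ f ∈ M, TightConn k Hc e f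


section aux

theorem tightConn_iff {V : Type*} [DecidableEq V] (k : ℕ) (Hc : Finset (Finset V)) (f f' : Finset V) :
    TightConn k Hc f f' ↔ f ∈ Hc ∧
      Relation.ReflTransGen (fun a b => b ∈ Hc ∧ (a ∩ b).card = k - 1) f f' := by
  constructor
  · rintro ⟨t, e, h0, ht, hm, hs⟩
    refine ⟨h0 ▸ hm 0 (Nat.zero_le _), ?_⟩
    have key : ∀ j, j ≤ t →
        Relation.ReflTransGen (fun a b => b ∈ Hc ∧ (a ∩ b).card = k - 1) (e 0) (e j) := by
      intro j
      induction j with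
      | zero => intro _; exact Relation.ReflTransGen.refl
      | succ j ih =>
        intro hj
        exact (ih (by omega)).tail ⟨hm _ hj, hs j (by omega)⟩
    rw [← h0, ← ht]
    exact key t le_rfl
  · rintro ⟨hf, h⟩
    induction h with
    | refl => exact ⟨0, fun _ => f, rfl, rfl, fun _ _ => hf, fun i hi => by omega⟩
    | @tail b c _ hbc ih =>
      obtain ⟨t, e, h0, ht, hm, hs⟩ := ih
      refine ⟨t + 1, fun i => if i ≤ t then e i else c, by simp [h0], by simp, ?_, ?_⟩
      · intro i hi
        by_cases h : i ≤ t
        · simp [h, hm i h]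
        · simp [h, hbc.1]
      · intro i hi
        by_cases h : i + 1 ≤ t
        · have h' : i ≤ t := by omega
          simp only [h, h', if_true]
          exact hs i (by omega)
        · have h' : i = t := by omega
          subst h'
          simp only [le_refl, if_true, h, if_false, ht]
          exact hbc.2

theorem tightConn_refl {V : Type*} [DecidableEq V] {k : ℕ} {Hc : Finset (Finset V)} {f : Finset V}
    (hf : f ∈ Hc) : TightConn k Hc f f :=
  (tightConn_iff ..).2 ⟨hf, Relation.ReflTransGen.refl⟩

theorem TightConn.mem_right {V : Type*} [DecidableEq V] {k : ℕ} {Hc : Finset (Finset V)}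
    {f g : Finset V} (h : TightConn k Hc f g) : g ∈ Hc := by
  obtain ⟨t, e, h0, ht, hm, hs⟩ := h
  exact ht ▸ hm t le_rfl

theorem TightConn.trans' {V : Type*} [DecidableEq V] {k : ℕ} {Hc : Finset (Finset V)}
    {f g h : Finset V} (h1 : TightConn k Hc f g) (h2 : TightConn k Hc g h) : TightConn k Hc f h := by
  rw [tightConn_iff] at *
  exact ⟨h1.1, h1.2.trans h2.2⟩

theorem TightConn.symm' {V : Type*} [DecidableEq V] {k : ℕ} {Hc : Finset (Finset V)}
    {f g : Finset V} (h1 : TightConn k Hc f g) : TightConn k Hc g f := by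
  obtain ⟨t, e, h0, ht, hm, hs⟩ := h1
  refine ⟨t, fun i => e (t - i), by simpa using ht, by simpa using h0,
    fun i _ => hm _ (by omega), fun i hi => ?_⟩
  have := hs (t - (i + 1)) (by omega)
  rw [show t - (i + 1) + 1 = t - i by omega] at this
  rwa [inter_comm]

open scoped Classical in
/-- tight component of `f` in `Hc`. -/
noncomputable def tcOf {V : Type*} [DecidableEq V] (k : ℕ) (Hc : Finset (Finset V)) (f : Finset V) :
    Finset (Finset V) := Hc.filter (fun g => TightConn k Hc f g)

theorem tcOf_isTC {V : Type*} [DecidableEq V] {k : ℕ} {Hc : Finset (Finset V)} {f : Finset V}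
    (hf : f ∈ Hc) : IsTightComponent k Hc (tcOf k Hc f) := by
  refine ⟨⟨fun a ha => by simp only [tcOf, mem_filter] at ha; exact ha.1, ?_⟩, ?_⟩
  · intro a ha b hb
    simp only [tcOf, mem_filter] at ha hb
    exact ha.2.symm'.trans' hb.2
  · intro C' hC' hsub
    apply Subset.antisymm _ hsub
    intro g hg
    simp only [tcOf, mem_filter]
    refine ⟨hC'.1 hg, hC'.2 f (hsub ?_) g hg⟩
    simp only [tcOf, mem_filter]
    exact ⟨hf, tightConn_refl hf⟩

theorem self_mem_tcOf {V : Type*} [DecidableEq V] {k : ℕ} {Hc : Finset (Finset V)} {f : Finset V}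
    (hf : f ∈ Hc) : f ∈ tcOf k Hc f := by
  simp only [tcOf, mem_filter]
  exact ⟨hf, tightConn_refl hf⟩

theorem tcOf_eq {V : Type*} [DecidableEq V] {k : ℕ} {Hc : Finset (Finset V)} {f g : Finset V}
    (h : TightConn k Hc f g) : tcOf k Hc f = tcOf k Hc g := by
  ext a
  simp only [tcOf, mem_filter]
  exact ⟨fun ⟨h1, h2⟩ => ⟨h1, h.symm'.trans' h2⟩, fun ⟨h1, h2⟩ => ⟨h1, h.trans' h2⟩⟩

theorem exists_tc {V : Type*} [DecidableEq V] (k : ℕ) (Hc : Finset (Finset V)) :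
    ∃ C, IsTightComponent k Hc C := by
  rcases Hc.eq_empty_or_nonempty with rfl | ⟨f, hf⟩
  · refine ⟨∅, ⟨by simp, by simp⟩, fun C' h _ => ?_⟩
    exact subset_empty.1 h.1
  · exact ⟨_, tcOf_isTC hf⟩

/-- component label of an edge. -/
noncomputable def labH {V : Type*} [DecidableEq V] (k : ℕ) (H : Finset (Finset V))
    (c : Finset V → Bool) (f : Finset V) : Finset (Finset V) :=
  tcOf k (H.filter (fun g => c g = c f)) f

theorem labH_eq {V : Type*} [DecidableEq V] {k : ℕ} {H : Finset (Finset V)}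
    {c : Finset V → Bool} {f g : Finset V} (hk : ∀ e ∈ H, e.card = k) (hf : f ∈ H) (hg : g ∈ H)
    (hc : c f = c g) (hfg : k - 1 ≤ (f ∩ g).card) : labH k H c f = labH k H c g := by
  by_cases h : f = g
  · rw [h]
  have hlt : (f ∩ g).card < k := by
    by_contra hcon
    have h1 : f ∩ g = f := eq_of_subset_of_card_le inter_subset_left (by rw [hk f hf]; omega)
    have h2 : f ∩ g = g := eq_of_subset_of_card_le inter_subset_right (by rw [hk g hg]; omega)
    exact h (h1.symm.trans h2)
  unfold labH
  rw [← hc]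
  apply tcOf_eq
  rw [tightConn_iff]
  refine ⟨by simp [hf], Relation.ReflTransGen.single ⟨by simp [hg, hc], by omega⟩⟩

end aux

section link
open scoped Classical

/-- number of elements with a property. -/
noncomputable def cnt {V : Type*} [Fintype V] (p : V → Prop) : ℝ := ((univ.filter p).card : ℝ)

theorem cnt_nonneg {V : Type*} [Fintype V] (p : V → Prop) : 0 ≤ cnt p := by
  unfold cnt; positivity

theorem cnt_le {V : Type*} [Fintype V] {p : V → Prop} (s : Finset V) (h : ∀ v, p v → v ∈ s) :
    cnt p ≤ (s.card : ℝ) := by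
  unfold cnt
  have : univ.filter p ⊆ s := fun v hv => h v (mem_filter.1 hv).2
  exact_mod_cast card_le_card this

theorem le_cnt {V : Type*} [Fintype V] {p : V → Prop} (s : Finset V) (h : ∀ v ∈ s, p v) :
    (s.card : ℝ) ≤ cnt p := by
  unfold cnt
  have : s ⊆ univ.filter p := fun v hv => mem_filter.2 ⟨mem_univ _, h v hv⟩
  exact_mod_cast card_le_card this

theorem card_eq_cnt {V : Type*} [Fintype V] {p : V → Prop} (s : Finset V) (h : ∀ v, v ∈ s ↔ p v) :
    (s.card : ℝ) = cnt p :=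
  le_antisymm (le_cnt s fun v hv => (h v).1 hv) (cnt_le s fun v hv => (h v).2 hv)

theorem cnt_mono {V : Type*} [Fintype V] {p q : V → Prop} (h : ∀ v, p v → q v) : cnt p ≤ cnt q :=
  cnt_le _ fun v hv => mem_filter.2 ⟨mem_univ _, h v hv⟩

theorem markov {V : Type*} [Fintype V] (f : V → ℝ) (hf : ∀ v, 0 ≤ f v) (t : ℝ) :
    t * cnt (fun v => t < f v) ≤ ∑ v, f v := by
  unfold cnt
  calc t * ((univ.filter (fun v => t < f v)).card : ℝ)
      = ∑ v ∈ univ.filter (fun v => t < f v), t := by simp [mul_comm]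
    _ ≤ ∑ v ∈ univ.filter (fun v => t < f v), f v := by
        apply sum_le_sum
        intro i hi
        exact (mem_filter.1 hi).2.le
    _ ≤ ∑ v, f v := sum_le_sum_of_subset_of_nonneg (filter_subset _ _) (fun i _ _ => hf i)

theorem cnt_compl {V : Type*} [Fintype V] (p : V → Prop) :
    cnt p = Fintype.card V - cnt (fun v => ¬ p v) := by
  have := card_filter_add_card_filter_not (s := (univ : Finset V)) p
  rw [card_univ] at this
  have h2 : ((univ.filter p).card : ℝ) + ((univ.filter (fun v => ¬ p v)).card : ℝ) = Fintype.card V := by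
    exact_mod_cast this
  rw [card_eq_cnt (p := p) _ (by simp), card_eq_cnt (p := fun v => ¬ p v) _ (by simp)] at h2
  linarith

theorem cnt_or {V : Type*} [Fintype V] {p : V → Prop} (q r : V → Prop) (h : ∀ v, p v → q v ∨ r v) :
    cnt p ≤ cnt q + cnt r := by
  have h1 := cnt_le (p := p) (univ.filter q ∪ univ.filter r) (by
    intro v hv
    simp only [mem_filter, mem_univ, true_and, mem_union] at *
    exact h v hv)
  have h2 := (card_union_le (univ.filter q) (univ.filter r))
  have h3 : ((univ.filter q ∪ univ.filter r).card : ℝ) ≤ (univ.filter q).card + (univ.filter r).card := by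
    exact_mod_cast h2
  exact h1.trans h3

theorem link {V X : Type*} [Fintype V] (L : V → V → Prop) (c : V → V → Bool)
    (l : V → V → X) (hL : ∀ u v, L u v → L v u) (hc : ∀ u v, c u v = c v u)
    (hls : ∀ u v, l u v = l v u)
    (hl : ∀ u v w, L u v → L u w → c u v = c u w → l u v = l u w)
    (τ : ℝ) (hτ : 0 < τ) (hτ1 : τ < 1 / 5) (hn : 0 < (Fintype.card V : ℝ))
    (hm : ∑ u, cnt (fun v => ¬ L u v) ≤ 9 / 4 * τ ^ 2 * (Fintype.card V : ℝ) ^ 2) :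
    ∃ b x, (1 - 3 * τ) * (Fintype.card V : ℝ) ≤
      cnt (fun z => ∃ u, L u z ∧ c u z = b ∧ l u z = x) := by
  set n : ℝ := (Fintype.card V : ℝ) with hndef
  set ms : V → ℝ := fun u => cnt (fun v => ¬ L u v) with hms
  set t : ℝ := 3 / 2 * τ * n with ht
  have htpos : 0 < t := by positivity
  set W : V → Prop := fun v => ¬ (t < ms v) with hW
  have hWc : cnt (fun v => t < ms v) ≤ t := by
    have h1 := markov ms (fun v => cnt_nonneg _) t
    have h2 : ∑ v, ms v ≤ t * t := by
      refine hm.trans (le_of_eq ?_)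
      rw [ht]; ring
    exact le_of_mul_le_mul_left (h1.trans h2) htpos
  -- nonneighbours of two vertices
  by_cases hA : ∃ u v, W u ∧ W v ∧ L u v ∧
      ¬ ∃ a b, L u a ∧ L v b ∧ c u a = false ∧ c v b = false ∧ l u a = l v b
  · obtain ⟨u, v, hu, hv, huv, hD⟩ := hA
    have hred : c u v = true := by
      by_contra hcon
      rw [Bool.not_eq_true] at hcon
      exact hD ⟨v, u, huv, hL _ _ huv, hcon, by rw [hc]; exact hcon, hls _ _⟩
    refine ⟨true, l u v, ?_⟩
    rw [cnt_compl]
    have := cnt_or (p := fun z => ¬ ∃ w, L w z ∧ c w z = true ∧ l w z = l u v)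
      (fun z => ¬ L u z) (fun z => ¬ L v z) (by
        intro z hz
        by_contra hcon
        push Not at hcon
        obtain ⟨h1, h2⟩ := hcon
        apply hz
        rcases hb : c u z with _ | _
        · rcases hb' : c v z with _ | _
          · exfalso
            apply hD
            refine ⟨z, z, h1, h2, hb, hb', ?_⟩
            rw [hls u z, hls v z]
            apply hl _ _ _ (hL _ _ h1) (hL _ _ h2)
            rw [hc, hb, hc, hb']
          · refine ⟨v, h2, hb', ?_⟩
            rw [hls u v]
            apply hl _ _ _ h2 (hL _ _ huv)
            rw [hb', hc, hred]
        · refine ⟨u, h1, hb, ?_⟩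
          apply hl _ _ _ h1 huv
          rw [hb, hred])
    have hu' : ms u ≤ t := not_lt.1 hu
    have hv' : ms v ≤ t := not_lt.1 hv
    have e1 : cnt (fun z => ¬ L u z) = ms u := rfl
    have e2 : cnt (fun z => ¬ L v z) = ms v := rfl
    rw [e1, e2] at this
    have : 2 * t = 3 * τ * n := by rw [ht]; ring
    linarith
  · push Not at hA
    have hWcard : n - t ≤ cnt W := by
      rw [cnt_compl]
      simp only [hW, not_not]
      linarith
    have hcommon : ∀ u v, W u → W v → ∃ z, W z ∧ L u z ∧ L v z := by
      intro u v hu hv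
      by_contra hcon
      push Not at hcon
      have h1 := cnt_or (p := W) (fun z => ¬ L u z) (fun z => ¬ L v z) (by
        intro z hz
        by_cases h : L u z
        · exact Or.inr (hcon z hz h)
        · exact Or.inl h)
      have hu' : ms u ≤ t := not_lt.1 hu
      have hv' : ms v ≤ t := not_lt.1 hv
      have e1 : cnt (fun z => ¬ L u z) = ms u := rfl
      have e2 : cnt (fun z => ¬ L v z) = ms v := rfl
      rw [e1, e2] at h1
      have : n ≤ 9 / 2 * τ * n := by rw [ht] at *; linarith
      nlinarith
    have hne : ∃ w, W w := by
      by_contra hcon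
      push Not at hcon
      have h0 := cnt_le (p := W) ∅ (fun v hv => absurd hv (hcon v))
      simp only [card_empty, Nat.cast_zero] at h0
      have : n ≤ 3 / 2 * τ * n := by rw [ht] at *; linarith
      nlinarith
    obtain ⟨w, hw⟩ := hne
    obtain ⟨z0, hz0, hwz0, -⟩ := hcommon w w hw hw
    obtain ⟨a0, b0, ha0, hb0, hca0, hcb0, hl0⟩ := hA w z0 hw hz0 hwz0
    refine ⟨false, l w a0, ?_⟩
    have h2 := cnt_mono (p := W) (q := fun z => ∃ u, L u z ∧ c u z = false ∧ l u z = l w a0) (by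
      intro z hz
      obtain ⟨y, hy, hwy, hzy⟩ := hcommon w z hw hz
      obtain ⟨a1, b1, h1, h2, h3, h4, h5⟩ := hA w y hw hy hwy
      obtain ⟨a2, b2, g1, g2, g3, g4, g5⟩ := hA z y hz hy hzy
      refine ⟨a2, hL _ _ g1, by rw [hc]; exact g3, ?_⟩
      rw [hls, g5, hl w a0 a1 ha0 h1 (by rw [hca0, h3]), h5]
      exact hl _ _ _ g2 h2 (by rw [g4, h4]))
    have h3 : t ≤ 3 * τ * n := by rw [ht]; nlinarith [mul_pos hτ hn]
    linarith

/-- neighbourhood with given colour and label. -/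
noncomputable def Nb {V X : Type*} [Fintype V] [DecidableEq V] (H : Finset (Finset V)) (c : Finset V → Bool)
    (l : Finset V → X) (e : Finset V) (b : Bool) (x : X) : Finset V :=
  univ.filter (fun z => ∃ u, insert u (insert z e) ∈ H ∧ c (insert u (insert z e)) = b ∧
    l (insert u (insert z e)) = x)

theorem choose_two_le (n : ℕ) : ((n.choose 2 : ℕ) : ℝ) ≤ (n : ℝ) ^ 2 / 2 := by
  rw [Nat.cast_choose_two]
  nlinarith [(Nat.cast_nonneg n : (0:ℝ) ≤ n)]

theorem linkH {V X : Type*} [Fintype V] [DecidableEq V] (r : ℕ) (H : Finset (Finset V))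
    (c : Finset V → Bool) (l : Finset V → X) (hH : ∀ f ∈ H, f.card = r + 2)
    (hl : ∀ f ∈ H, ∀ g ∈ H, c f = c g → r + 1 ≤ (f ∩ g).card → l f = l g)
    (e : Finset V) (he : e.card = r) (ε : ℝ) (hε : 0 < ε) (hε1 : ε < 1 / 25)
    (hn : 4 / ε ≤ (Fintype.card V : ℝ))
    (hd : (1 - ε) * ((Fintype.card V).choose 2 : ℝ) ≤ (degT (r + 2) H e : ℝ)) :
    ∃ b x, (1 - 3 * Real.sqrt ε) * (Fintype.card V : ℝ) ≤ ((Nb H c l e b x).card : ℝ) := by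
  have hn0 : 0 < (Fintype.card V : ℝ) := lt_of_lt_of_le (by positivity) hn
  have hs : Real.sqrt ε ^ 2 = ε := Real.sq_sqrt hε.le
  have hNb : ∀ b x, ((Nb H c l e b x).card : ℝ) = cnt (fun z => ∃ u, insert u (insert z e) ∈ H ∧
      c (insert u (insert z e)) = b ∧ l (insert u (insert z e)) = x) := fun b x =>
    card_eq_cnt _ (by simp [Nb])
  simp only [hNb]
  apply link (fun u z => insert u (insert z e) ∈ H) (fun u z => c (insert u (insert z e)))
    (fun u z => l (insert u (insert z e)))
  · intro u v h
    rwa [insert_comm]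
  · intro u v
    rw [insert_comm]
  · intro u v
    rw [insert_comm]
  · intro u v w h1 h2 h3
    apply hl _ h1 _ h2 h3
    have hu : insert u e ⊆ insert u (insert v e) ∩ insert u (insert w e) := by
      intro a ha
      simp only [mem_inter, mem_insert] at *
      tauto
    refine le_trans ?_ (card_le_card hu)
    have : u ∉ e := by
      intro hue
      have h4 := hH _ h1
      rw [insert_eq_of_mem (mem_insert_of_mem hue)] at h4
      have := card_insert_le v e
      omega
    rw [card_insert_of_notMem this, he]
  · exact Real.sqrt_pos.2 hε
  · rw [show (1 / 5 : ℝ) = Real.sqrt (1 / 25) by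
      rw [show (1 / 25 : ℝ) = (1 / 5) ^ 2 by norm_num, Real.sqrt_sq (by norm_num)]]
    exact Real.sqrt_lt_sqrt hε.le hε1
  · exact hn0
  · rw [hs]
    -- bad pairs
    set B : Finset (Finset V) := (univ.powersetCard 2).filter (fun p => ¬ (p ∪ e ∈ H)) with hB
    have hBc : (B.card : ℝ) ≤ ε * ((Fintype.card V).choose 2 : ℝ) := by
      have h1 := card_filter_add_card_filter_not (s := (univ : Finset V).powersetCard 2) (fun p => p ∪ e ∈ H)
      rw [card_powersetCard, card_univ] at h1
      have h2 : degT (r + 2) H e = (((univ : Finset V).powersetCard 2).filter (fun p => p ∪ e ∈ H)).card := by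
        unfold degT degOn
        rw [he, Nat.add_sub_cancel_left]
      rw [h2] at hd
      have h3 : ((((univ : Finset V).powersetCard 2).filter (fun p => p ∪ e ∈ H)).card : ℝ) + (B.card : ℝ)
          = ((Fintype.card V).choose 2 : ℝ) := by exact_mod_cast h1
      linarith
    have hsum : ∑ u, cnt (fun v => ¬ insert u (insert v e) ∈ H) ≤
        4 * (B.card : ℝ) + (Fintype.card V : ℝ) := by
      have heq : ∀ u, cnt (fun v => ¬ insert u (insert v e) ∈ H) =
          ((univ.filter (fun v => ¬ insert u (insert v e) ∈ H)).card : ℝ) := fun u =>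
        (card_eq_cnt _ (by simp)).symm
      simp only [heq]
      have h1 : ∑ u, (univ.filter (fun v => ¬ insert u (insert v e) ∈ H)).card
          = ((univ : Finset V).sigma (fun u => univ.filter (fun v => ¬ insert u (insert v e) ∈ H))).card := by
        rw [card_sigma]
      have h2 : ((univ : Finset V).sigma (fun u => univ.filter (fun v => ¬ insert u (insert v e) ∈ H))) ⊆
          (B.biUnion (fun p => p.sigma (fun _ => p))) ∪ univ.image (fun u => (⟨u, u⟩ : (_ : V) × V)) := by
        rintro ⟨u, v⟩ h
        simp only [mem_sigma, mem_univ, mem_filter, true_and] at h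
        simp only [mem_union, mem_biUnion, mem_sigma, mem_image, mem_univ, true_and]
        by_cases huv : u = v
        · right; exact ⟨u, by rw [huv]⟩
        · left
          refine ⟨{u, v}, ?_, by simp, by simp⟩
          simp only [hB, mem_filter, mem_powersetCard, subset_univ, true_and]
          refine ⟨card_pair huv, ?_⟩
          rw [insert_union, singleton_union]
          exact h
      have h3 := (card_le_card h2).trans (card_union_le _ _)
      have h4 : (B.biUnion (fun p => p.sigma (fun _ => p))).card ≤ B.card * 4 := by
        apply card_biUnion_le_card_mul
        intro p hp
        simp only [hB, mem_filter, mem_powersetCard] at hp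
        rw [card_sigma, sum_const, hp.1.2]; rfl
      have h5 : (univ.image (fun u : V => (⟨u, u⟩ : (_ : V) × V))).card ≤ Fintype.card V :=
        card_image_le
      rw [← h1] at h3
      have h6 : ∑ u, (univ.filter (fun v => ¬ insert u (insert v e) ∈ H)).card ≤
        4 * B.card + Fintype.card V := by omega
      exact_mod_cast h6
    refine hsum.trans ?_
    have h7 := choose_two_le (Fintype.card V)
    rw [div_le_iff₀ hε] at hn
    have h8 : ε * ((Fintype.card V).choose 2 : ℝ) ≤ ε * ((Fintype.card V : ℝ) ^ 2 / 2) :=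
      mul_le_mul_of_nonneg_left h7 hε.le
    nlinarith

/-- Star lemma. -/
theorem star {V X : Type*} [Fintype V] [DecidableEq V] [Nonempty X] (r : ℕ) (H : Finset (Finset V))
    (c : Finset V → Bool) (l : Finset V → X)
    (hl : ∀ f ∈ H, ∀ g ∈ H, c f = c g → r + 2 ≤ (f ∩ g).card → l f = l g)
    (good : Finset V → Prop) (col : Finset V → Bool) (lab : Finset V → X) (d : ℝ) (hd0 : 0 ≤ d)
    (hgood : ∀ e, e.card = r + 1 → good e →
      (Fintype.card V : ℝ) - d ≤ ((Nb H c l e (col e) (lab e)).card : ℝ))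
    (S : Finset V) (hS : S.card = r) (b : Bool) :
    ∃ x0 : X, cnt (fun x => x ∉ S ∧ good (insert x S) ∧ col (insert x S) = b ∧
      lab (insert x S) ≠ x0) ≤ 2 * d := by
  set A : Finset V := univ.filter (fun x => x ∉ S ∧ good (insert x S) ∧ col (insert x S) = b) with hA
  set arr : V → V → Prop := fun x y => y ∈ Nb H c l (insert x S) (col (insert x S)) (lab (insert x S)) with harr
  have hout : ∀ x ∈ A, cnt (fun y => ¬ arr x y) ≤ d := by
    intro x hx
    simp only [hA, mem_filter, mem_univ, true_and] at hx
    have h1 := hgood (insert x S) (by rw [card_insert_of_notMem hx.1, hS]) hx.2.1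
    have h2 := cnt_compl (arr x)
    rw [← card_eq_cnt (Nb H c l (insert x S) (col (insert x S)) (lab (insert x S))) (by simp [harr])] at h2
    linarith
  have hcomp : ∀ x ∈ A, ∀ y ∈ A, x ≠ y → arr x y → arr y x → lab (insert x S) = lab (insert y S) := by
    intro x hx y hy hxy h1 h2
    simp only [hA, mem_filter, mem_univ, true_and] at hx hy
    simp only [harr, Nb, mem_filter, mem_univ, true_and] at h1 h2
    obtain ⟨u, hu, hcu, hlu⟩ := h1
    obtain ⟨w, hw, hcw, hlw⟩ := h2
    rw [← hlu, ← hlw]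
    apply hl _ hu _ hw
    · rw [hcu, hcw, hx.2.2, hy.2.2]
    · have hsub : insert x (insert y S) ⊆ insert u (insert y (insert x S)) ∩ insert w (insert x (insert y S)) := by
        intro a ha
        simp only [mem_inter, mem_insert] at *
        tauto
      refine le_trans ?_ (card_le_card hsub)
      rw [card_insert_of_notMem (by simp [hxy, hx.1]), card_insert_of_notMem hy.1, hS]
  rcases A.eq_empty_or_nonempty with hemp | hne
  · refine ⟨Classical.arbitrary X, ?_⟩
    have h1 := cnt_le (p := fun x => x ∉ S ∧ good (insert x S) ∧ col (insert x S) = b ∧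
      lab (insert x S) ≠ Classical.arbitrary X) ∅ (by
      rintro x ⟨h1, h2, h3, -⟩
      have : x ∈ A := by simp [hA, h1, h2, h3]
      rwa [hemp] at this)
    simp only [card_empty, Nat.cast_zero] at h1
    linarith
  · -- averaging
    have hex : ∃ x ∈ A, ((A.filter (fun y => ¬ arr y x)).card : ℝ) ≤ d := by
      by_contra hcon
      push Not at hcon
      have h1 : ∑ x ∈ A, ((A.filter (fun y => ¬ arr y x)).card : ℝ) =
          ∑ y ∈ A, ((A.filter (fun x => ¬ arr y x)).card : ℝ) := by
        have := sum_card_bipartiteAbove_eq_sum_card_bipartiteBelow (s := A) (t := A) (fun x y => ¬ arr y x)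
        unfold bipartiteAbove bipartiteBelow at this
        exact_mod_cast this
      have h2 : ∑ y ∈ A, ((A.filter (fun x => ¬ arr y x)).card : ℝ) ≤ ∑ y ∈ A, d := by
        apply sum_le_sum
        intro y hy
        refine le_trans ?_ (hout y hy)
        exact le_cnt _ (fun v hv => (mem_filter.1 hv).2)
      have h3 : ∑ x ∈ A, d < ∑ x ∈ A, ((A.filter (fun y => ¬ arr y x)).card : ℝ) :=
        sum_lt_sum_of_nonempty hne hcon
      linarith
    obtain ⟨x, hx, hin⟩ := hex
    refine ⟨lab (insert x S), ?_⟩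
    have h1 := cnt_or (p := fun y => y ∉ S ∧ good (insert y S) ∧ col (insert y S) = b ∧
      lab (insert y S) ≠ lab (insert x S)) (fun y => y ∈ A ∧ ¬ arr y x) (fun y => ¬ arr x y) (by
      intro y hy
      have hyA : y ∈ A := by simp [hA, hy.1, hy.2.1, hy.2.2.1]
      by_contra hcon
      push Not at hcon
      have hne : x ≠ y := by
        rintro rfl
        exact hy.2.2.2 rfl
      exact hy.2.2.2 (hcomp x hx y hyA hne hcon.2 (hcon.1 hyA)).symm)
    have h2 := cnt_le (p := fun y => y ∈ A ∧ ¬ arr y x) (A.filter (fun y => ¬ arr y x))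
      (fun v hv => mem_filter.2 hv)
    have := hout x hx
    linarith

/-- degree into a shadow. -/
theorem deg_shadow {V : Type*} [Fintype V] [DecidableEq V] (r : ℕ) (e : Finset V) (he : e.card = r)
    (F : Finset (Finset V)) (N : Finset V) (hN : ∀ z ∈ N, z ∉ e ∧ ∃ f ∈ F, insert z e ⊆ f) :
    N.card ≤ degT (r + 1) (shadowTo (r + 1) F) e := by
  unfold degT degOn
  rw [he, Nat.add_sub_cancel_left]
  apply card_le_card_of_injOn (fun z => ({z} : Finset V))
  · intro z hz
    obtain ⟨h1, f, hf, h2⟩ := hN z hz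
    simp only [coe_filter, Set.mem_ofPred_eq, mem_powersetCard, subset_univ, true_and, card_singleton,
      shadowTo, mem_filter, singleton_union]
    exact ⟨by rw [card_insert_of_notMem h1, he], f, hf, h2⟩
  · intro a _ b _ h
    simpa using h

end link

section clean
open scoped Classical

theorem cnt_eq_sum {V : Type*} [Fintype V] (p : V → Prop) [DecidablePred p] :
    cnt p = ∑ v, if p v then (1 : ℝ) else 0 := by
  rw [← card_eq_cnt (univ.filter p) (by simp), card_filter]
  push_cast
  rfl

theorem cnt_pair {V W : Type*} [Fintype V] [Fintype W] (R : V → W → Prop) :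
    ∑ x, cnt (R x) = cnt (fun t : V × W => R t.1 t.2) := by
  simp only [cnt_eq_sum, Fintype.sum_prod_type]

theorem cnt_triple {V : Type*} [Fintype V] (R : V → V → V → Prop) :
    ∑ x, ∑ y, cnt (R x y) = cnt (fun t : V × V × V => R t.1 t.2.1 t.2.2) := by
  simp only [cnt_eq_sum, Fintype.sum_prod_type]

theorem cnt_le_card {V : Type*} [Fintype V] (p : V → Prop) : cnt p ≤ Fintype.card V := by
  rw [← card_univ]
  exact cnt_le _ (fun v _ => mem_univ v)

theorem pairs_le {V : Type*} [Fintype V] [DecidableEq V] (B : Finset (Finset V))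
    (hB : ∀ p ∈ B, p.card = 2) (R : V → V → Prop) (h : ∀ y z, {y, z} ∈ B → R y z) :
    (B.card : ℝ) ≤ ∑ y, cnt (R y) := by
  rw [cnt_pair]
  have hsub : B ⊆ (univ.filter (fun t : V × V => R t.1 t.2)).image (fun t => {t.1, t.2}) := by
    intro p hp
    obtain ⟨y, z, _, rfl⟩ := card_eq_two.1 (hB p hp)
    simp only [mem_image, mem_filter, mem_univ, true_and]
    exact ⟨(y, z), h y z hp, rfl⟩
  have h1 := (card_le_card hsub).trans card_image_le
  have h2 : (B.card : ℝ) ≤ ((univ.filter (fun t : V × V => R t.1 t.2)).card : ℝ) := by exact_mod_cast h1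
  exact h2

theorem ordered {V : Type*} [Fintype V] [DecidableEq V] (G0 : Finset (Finset V)) :
    ∑ x, ∑ y, cnt (fun z : V => ({x, y, z} : Finset V) ∉ G0) ≤
      27 * (((univ.powersetCard 3) \ G0).card : ℝ) + 3 * (Fintype.card V : ℝ) ^ 2 := by
  rw [cnt_triple (fun x y z : V => ({x, y, z} : Finset V) ∉ G0)]
  set D : Finset (Finset V) := (univ.powersetCard 3) \ G0 with hD
  have h1 := cnt_le (p := fun t : V × V × V => ({t.1, t.2.1, t.2.2} : Finset V) ∉ G0)
    ((D.biUnion (fun T => T ×ˢ T ×ˢ T)) ∪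
      ((univ.image (fun t : V × V => (t.1, t.1, t.2))) ∪
      ((univ.image (fun t : V × V => (t.1, t.2, t.1))) ∪
      (univ.image (fun t : V × V => (t.2, t.1, t.1)))))) (by
    rintro ⟨x, y, z⟩ h
    simp only [mem_union, mem_biUnion, mem_product, mem_image, mem_univ, true_and, Prod.exists,
      Prod.mk.injEq] at h ⊢
    by_cases hxy : x = y
    · subst hxy
      exact Or.inr (Or.inl ⟨x, z, rfl, rfl, rfl⟩)
    by_cases hxz : x = z
    · subst hxz
      exact Or.inr (Or.inr (Or.inl ⟨x, y, rfl, rfl, rfl⟩))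
    by_cases hyz : y = z
    · subst hyz
      exact Or.inr (Or.inr (Or.inr ⟨y, x, rfl, rfl, rfl⟩))
    refine Or.inl ⟨{x, y, z}, ?_, by simp, by simp, by simp⟩
    simp only [hD, mem_sdiff, mem_powersetCard, subset_univ, true_and]
    exact ⟨card_eq_three.2 ⟨x, y, z, hxy, hxz, hyz, rfl⟩, h⟩)
  refine h1.trans ?_
  have h2 : (D.biUnion (fun T => T ×ˢ T ×ˢ T)).card ≤ D.card * 27 := by
    apply card_biUnion_le_card_mul
    intro T hT
    simp only [hD, mem_sdiff, mem_powersetCard] at hT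
    rw [card_product, card_product, hT.1.2]
  have h3 : ∀ f : V × V → V × V × V, (univ.image f).card ≤ Fintype.card V ^ 2 := by
    intro f
    refine card_image_le.trans ?_
    rw [card_univ, Fintype.card_prod, sq]
  have h4 := h3 (fun t : V × V => (t.1, t.1, t.2))
  have h5 := h3 (fun t : V × V => (t.1, t.2, t.1))
  have h6 := h3 (fun t : V × V => (t.2, t.1, t.1))
  have h7 := card_union_le (D.biUnion (fun T => T ×ˢ T ×ˢ T))
      ((univ.image (fun t : V × V => (t.1, t.1, t.2))) ∪
      ((univ.image (fun t : V × V => (t.1, t.2, t.1))) ∪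
      (univ.image (fun t : V × V => (t.2, t.1, t.1)))))
  have h8 := card_union_le (univ.image (fun t : V × V => (t.1, t.1, t.2)))
      ((univ.image (fun t : V × V => (t.1, t.2, t.1))) ∪
      (univ.image (fun t : V × V => (t.2, t.1, t.1))))
  have h9 := card_union_le (univ.image (fun t : V × V => (t.1, t.2, t.1)))
      (univ.image (fun t : V × V => (t.2, t.1, t.1)))
  have h10 : (((D.biUnion (fun T => T ×ˢ T ×ˢ T)) ∪
      ((univ.image (fun t : V × V => (t.1, t.1, t.2))) ∪
      ((univ.image (fun t : V × V => (t.1, t.2, t.1))) ∪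
      (univ.image (fun t : V × V => (t.2, t.1, t.1)))))).card) ≤ 27 * D.card + 3 * Fintype.card V ^ 2 := by
    omega
  exact_mod_cast h10

/-- degree via complement -/
theorem deg_compl {V : Type*} [Fintype V] [DecidableEq V] (k j : ℕ) (H : Finset (Finset V)) (S : Finset V)
    (hj : k - S.card = j) :
    (degT k H S : ℝ) = ((Fintype.card V).choose j : ℝ) -
      ((((univ : Finset V).powersetCard j).filter (fun p => ¬ p ∪ S ∈ H)).card : ℝ) := by
  have h1 := card_filter_add_card_filter_not (s := (univ : Finset V).powersetCard j) (fun p => p ∪ S ∈ H)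
  rw [card_powersetCard, card_univ] at h1
  have h2 : degT k H S = (((univ : Finset V).powersetCard j).filter (fun p => p ∪ S ∈ H)).card := by
    unfold degT degOn
    rw [hj]
  rw [h2]
  have h3 : ((((univ : Finset V).powersetCard j).filter (fun p => p ∪ S ∈ H)).card : ℝ) +
      ((((univ : Finset V).powersetCard j).filter (fun p => ¬ p ∪ S ∈ H)).card : ℝ)
      = ((Fintype.card V).choose j : ℝ) := by exact_mod_cast h1
  linarith

theorem degT_eq_zero {V : Type*} [Fintype V] [DecidableEq V] (k : ℕ) (H : Finset (Finset V)) (S : Finset V)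
    (h : ∀ T ∈ H, ¬ S ⊆ T) : degT k H S = 0 := by
  unfold degT degOn
  rw [card_eq_zero]
  apply filter_false_of_mem
  intro p _ hp
  exact h _ hp subset_union_right

theorem clean {V : Type*} [Fintype V] [DecidableEq V] (G0 : Finset (Finset V))
    (γ : ℝ) (hγ : 0 < γ) (hγ1 : γ ≤ 1) (hN2 : 2 ≤ Fintype.card V)
    (hm : ∑ x, ∑ y, cnt (fun z : V => ({x, y, z} : Finset V) ∉ G0) ≤ (γ / 30) ^ 4 * (Fintype.card V : ℝ) ^ 3) :
    ∃ G, G ⊆ G0 ∧ IsDense 3 G (1 - γ) γ := by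
  set N : ℝ := (Fintype.card V : ℝ) with hN
  have hN2' : (2 : ℝ) ≤ N := by rw [hN]; exact_mod_cast hN2
  have hNpos : 0 < N := by linarith
  set η : ℝ := γ / 30 with hη
  have hηpos : 0 < η := by positivity
  have hη1 : η ≤ 1 := by rw [hη]; linarith
  have hγη : γ = 30 * η := by rw [hη]; ring
  have hch : N ^ 2 / 4 ≤ ((Fintype.card V).choose 2 : ℝ) := by
    rw [Nat.cast_choose_two]
    rw [← hN]
    nlinarith
  set P : V → V → Prop := fun x y => η ^ 2 * N < cnt (fun z : V => ({x, y, z} : Finset V) ∉ G0) with hP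
  have hPsymm : ∀ x y, P x y → P y x := by
    intro x y h
    simp only [hP] at h ⊢
    simpa only [insert_comm y x] using h
  have hPsum : ∑ x, cnt (P x) ≤ η ^ 2 * N ^ 2 := by
    have h1 : η ^ 2 * N * ∑ x, cnt (P x) ≤ (η ^ 2 * N) * (η ^ 2 * N ^ 2) := by
      rw [mul_sum]
      calc ∑ x, η ^ 2 * N * cnt (P x) ≤ ∑ x, ∑ y, cnt (fun z : V => ({x, y, z} : Finset V) ∉ G0) :=
            sum_le_sum (fun x _ => markov _ (fun v => cnt_nonneg _) _)
        _ ≤ _ := hm.trans (le_of_eq (by ring))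
    exact le_of_mul_le_mul_left h1 (by positivity)
  set U : V → Prop := fun x => η * N < cnt (P x) with hU
  have hUc : cnt U ≤ η * N := by
    have h1 : η * N * cnt U ≤ (η * N) * (η * N) := by
      refine (markov _ (fun v => cnt_nonneg _) _).trans (hPsum.trans (le_of_eq (by ring)))
    exact le_of_mul_le_mul_left h1 (by positivity)
  set Q : V → V → Prop := fun x y => ¬ P x y ∧ ¬ U x ∧ ¬ U y with hQ
  have hQsymm : ∀ x y, Q x y → Q y x := fun x y h => ⟨fun h' => h.1 (hPsymm _ _ h'), h.2.2, h.2.1⟩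
  have hQdeg : ∀ x, ¬ U x → cnt (fun y => ¬ Q x y) ≤ 2 * η * N := by
    intro x hx
    have h1 := cnt_or (p := fun y => ¬ Q x y) (P x) U (by
      intro y hy
      by_contra hcon
      push Not at hcon
      exact hy ⟨hcon.1, hx, hcon.2⟩)
    have h2 : cnt (P x) ≤ η * N := not_lt.1 hx
    linarith
  set G : Finset (Finset V) := G0.filter (fun T => ∀ a ∈ T, ∀ b ∈ T, a ≠ b → Q a b) with hG
  have hpair : ∀ x y, Q x y → cnt (fun z : V => ({x, y, z} : Finset V) ∉ G) ≤ 5 * η * N := by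
    intro x y hxy
    have h1 := cnt_or (p := fun z : V => ({x, y, z} : Finset V) ∉ G)
      (fun z : V => ({x, y, z} : Finset V) ∉ G0) (fun z => ¬ Q x z ∨ ¬ Q y z) (by
      intro z hz
      by_contra hcon
      push Not at hcon
      obtain ⟨h1, h2, h3⟩ := hcon
      apply hz
      simp only [hG, mem_filter]
      refine ⟨h1, ?_⟩
      intro a ha b hb hab
      simp only [mem_insert, mem_singleton] at ha hb
      rcases ha with rfl | rfl | rfl <;> rcases hb with rfl | rfl | rfl <;>
        first
        | exact absurd rfl hab
        | assumption
        | (apply hQsymm; assumption))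
    have h2 := cnt_or (p := fun z => ¬ Q x z ∨ ¬ Q y z) (fun z => ¬ Q x z) (fun z => ¬ Q y z) (fun _ h => h)
    have h3 := hQdeg x hxy.2.1
    have h4 := hQdeg y hxy.2.2
    have h5 : cnt (fun z : V => ({x, y, z} : Finset V) ∉ G0) ≤ η ^ 2 * N := not_lt.1 hxy.1
    have h6 : η ^ 2 * N ≤ η * N := by
      apply mul_le_mul_of_nonneg_right _ hNpos.le
      nlinarith
    linarith
  -- degree dichotomy
  have hd2 : ∀ x y, x ≠ y → Q x y → (1 - γ) * N ≤ (degT 3 G {x, y} : ℝ) := by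
    intro x y hne hxy
    rw [deg_compl 3 1 G {x, y} (by rw [card_pair hne]), Nat.choose_one_right]
    have h1 : ((((univ : Finset V).powersetCard 1).filter (fun p => ¬ p ∪ {x, y} ∈ G)).card : ℝ) ≤
        cnt (fun z : V => ({x, y, z} : Finset V) ∉ G) := by
      have h2 : (((univ : Finset V).powersetCard 1).filter (fun p => ¬ p ∪ {x, y} ∈ G)) ⊆
          (univ.filter (fun z : V => ({x, y, z} : Finset V) ∉ G)).image (fun z => {z}) := by
        intro p hp
        simp only [mem_filter, mem_powersetCard] at hp
        obtain ⟨z, rfl⟩ := card_eq_one.1 hp.1.2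
        simp only [mem_image, mem_filter, mem_univ, true_and]
        refine ⟨z, ?_, rfl⟩
        have h3 := hp.2
        rwa [singleton_union, show insert z ({x, y} : Finset V) = {x, y, z} by ext; simp; tauto] at h3
      have h4 := (card_le_card h2).trans card_image_le
      refine le_trans ?_ (le_cnt (univ.filter (fun z : V => ({x, y, z} : Finset V) ∉ G)) (by simp))
      exact_mod_cast h4
    have h2 := hpair x y hxy
    rw [← hN, hγη]
    have : 0 < η * N := by positivity
    nlinarith
  have hd2' : ∀ x y, x ≠ y → ¬ Q x y → degT 3 G {x, y} = 0 := by
    intro x y hne hxy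
    apply degT_eq_zero
    intro T hT hs
    simp only [hG, mem_filter] at hT
    exact hxy (hT.2 x (hs (by simp)) y (hs (by simp)) hne)
  have hd1 : ∀ v, ¬ U v → (1 - γ) * ((Fintype.card V).choose 2 : ℝ) ≤ (degT 3 G {v} : ℝ) := by
    intro v hv
    rw [deg_compl 3 2 G {v} (by simp)]
    have h1 := pairs_le (((univ : Finset V).powersetCard 2).filter (fun p => ¬ p ∪ {v} ∈ G)) (by
      intro p hp
      exact (mem_powersetCard.1 (mem_filter.1 hp).1).2) (fun y z => ({v, y, z} : Finset V) ∉ G) (by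
      intro y z h
      have h3 := (mem_filter.1 h).2
      rwa [union_comm, singleton_union] at h3)
    have h2 : ∑ y, cnt (fun z => ({v, y, z} : Finset V) ∉ G) ≤
        ∑ y, (5 * η * N + N * if ¬ Q v y then (1 : ℝ) else 0) := by
      apply sum_le_sum
      intro y _
      by_cases hq : Q v y
      · simpa [hq] using hpair v y hq
      · simp only [hq, not_false_eq_true, if_true]
        have := cnt_le_card (fun z => ({v, y, z} : Finset V) ∉ G)
        have h5 : 0 < 5 * η * N := by positivity
        linarith
    rw [sum_add_distrib, sum_const, ← mul_sum, ← cnt_eq_sum (fun y => ¬ Q v y), card_univ, nsmul_eq_mul, ← hN] at h2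
    have h3 := hQdeg v hv
    have h4 : N * cnt (fun y => ¬ Q v y) ≤ N * (2 * η * N) := mul_le_mul_of_nonneg_left h3 hNpos.le
    have h5 : γ * (N ^ 2 / 4) ≤ γ * ((Fintype.card V).choose 2 : ℝ) := mul_le_mul_of_nonneg_left hch hγ.le
    rw [hγη] at h5 ⊢
    have : 0 < η * N ^ 2 := by positivity
    nlinarith
  have hd1' : ∀ v, U v → degT 3 G {v} = 0 := by
    intro v hv
    unfold degT degOn
    rw [card_eq_zero]
    apply filter_false_of_mem
    intro p hp hpG
    simp only [card_singleton, mem_powersetCard, subset_univ, true_and] at hp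
    have : ∃ w ∈ p, w ≠ v := by
      by_contra hcon
      push Not at hcon
      have h1 : p ⊆ {v} := fun w hw => by simpa using hcon w hw
      have := card_le_card h1
      rw [card_singleton, hp] at this
      omega
    obtain ⟨w, hw, hwv⟩ := this
    simp only [hG, mem_filter] at hpG
    exact (hpG.2 v (by simp) w (by simp [hw]) hwv.symm).2.1 hv
  refine ⟨G, filter_subset _ _, ?_⟩
  intro i hi1 hi2
  have hi : i = 1 ∨ i = 2 := by omega
  rcases hi with rfl | rfl
  · constructor
    · have h1 : {S : Finset V | S.card = 1 ∧
          (degT 3 G S : ℝ) < (1 - γ) * ((Fintype.card V).choose (3 - 1))} ⊆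
          (((univ.filter U).image (fun v => ({v} : Finset V)) : Finset (Finset V)) : Set (Finset V)) := by
        rintro S ⟨hS, hlt⟩
        obtain ⟨v, rfl⟩ := card_eq_one.1 hS
        simp only [coe_image, coe_filter, mem_univ, true_and, Set.mem_image]
        refine ⟨v, ?_, rfl⟩
        by_contra hcon
        exact absurd hlt (not_lt.2 (hd1 v hcon))
      have h2 := Set.ncard_le_ncard h1 (Finset.finite_toSet _)
      rw [Set.ncard_coe_finset] at h2
      have h3 := h2.trans card_image_le
      have h4 : (({S : Finset V | S.card = 1 ∧
          (degT 3 G S : ℝ) < (1 - γ) * ((Fintype.card V).choose (3 - 1))}.ncard : ℕ) : ℝ) ≤ cnt U := by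
        unfold cnt
        exact_mod_cast h3
      refine h4.trans (hUc.trans ?_)
      rw [Nat.choose_one_right, ← hN, hγη]
      have : 0 < η * N := by positivity
      nlinarith
    · intro S hS hlt
      obtain ⟨v, rfl⟩ := card_eq_one.1 hS
      apply hd1'
      by_contra hcon
      exact absurd hlt (not_lt.2 (hd1 v hcon))
  · constructor
    · set B : Finset (Finset V) := univ.filter (fun S => S.card = 2 ∧
          (degT 3 G S : ℝ) < (1 - γ) * ((Fintype.card V).choose (3 - 2))) with hB
      have h1 : {S : Finset V | S.card = 2 ∧
          (degT 3 G S : ℝ) < (1 - γ) * ((Fintype.card V).choose (3 - 2))} = (B : Set (Finset V)) := by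
        ext S; simp [hB]
      rw [h1, Set.ncard_coe_finset]
      have h2 := pairs_le B (fun p hp => by simp only [hB, mem_filter] at hp; exact hp.2.1) (fun x y => ¬ Q x y) (by
        intro y z h hq
        simp only [hB, mem_filter] at h
        have hne : y ≠ z := by
          rintro rfl
          simp at h
        have h3 := hd2 y z hne hq
        have h4 := h.2.2
        rw [show 3 - 2 = 1 from rfl, Nat.choose_one_right, ← hN] at h4
        linarith)
      have h3 : ∑ x, cnt (fun y => ¬ Q x y) ≤ ∑ x, (cnt (P x) + cnt U + N * if U x then (1 : ℝ) else 0) := by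
        apply sum_le_sum
        intro x _
        by_cases hx : U x
        · have := cnt_le_card (fun y => ¬ Q x y)
          have h5 := cnt_nonneg (P x)
          have h6 := cnt_nonneg U
          simp only [hx, if_true]
          linarith
        · simp only [hx, if_false, mul_zero, add_zero]
          apply cnt_or
          intro y hy
          by_contra hcon
          push Not at hcon
          exact hy ⟨hcon.1, hx, hcon.2⟩
      rw [sum_add_distrib, sum_add_distrib, ← mul_sum, ← cnt_eq_sum U, sum_const, card_univ, nsmul_eq_mul, ← hN] at h3
      have h4 : N * cnt U ≤ N * (η * N) := mul_le_mul_of_nonneg_left hUc hNpos.le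
      have h5 : γ * (N ^ 2 / 4) ≤ γ * ((Fintype.card V).choose 2 : ℝ) := mul_le_mul_of_nonneg_left hch hγ.le
      refine le_trans ?_ h5
      have h6 : η ^ 2 * N ^ 2 ≤ η * N ^ 2 := by
        apply mul_le_mul_of_nonneg_right _ (by positivity)
        nlinarith
      have : 0 < η * N ^ 2 := by positivity
      rw [hγη]
      nlinarith
    · intro S hS hlt
      obtain ⟨x, y, hne, rfl⟩ := card_eq_two.1 hS
      apply hd2' x y hne
      intro hq
      have h3 := hd2 x y hne hq
      rw [show 3 - 2 = 1 from rfl, Nat.choose_one_right, ← hN] at hlt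
      linarith

end clean

section main
open scoped Classical

theorem stage1 {V : Type*} [Fintype V] [DecidableEq V] (H : Finset (Finset V)) (cH : Finset V → Bool)
    (hH : ∀ e ∈ H, e.card = 5) (ε α : ℝ) (hε : 0 < ε) (hε1 : ε < 1 / 25) (hα : 0 < α)
    (hεα : Real.sqrt ε ≤ α / 36) (hn : 4 / ε ≤ (Fintype.card V : ℝ))
    (hs3 : 3 * Real.sqrt ε < 1)
    (hd : IsDense 5 H (1 - ε) α) :
    ∃ (G0 : Finset (Finset V)) (col : Finset V → Bool) (lab : Finset V → Finset (Finset V)),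
      (∀ e ∈ G0, e.card = 3) ∧
      (∀ e ∈ G0, IsTightComponent 5 (H.filter (fun f => cH f = col e)) (lab e)) ∧
      (∀ e ∈ G0, (1 - 3 * Real.sqrt ε) * (Fintype.card V : ℝ) ≤ (degT 4 (shadowTo 4 (lab e)) e : ℝ)) ∧
      (∀ e ∈ G0, ∀ e' ∈ G0, col e = col e' → (e ∩ e').card = 2 → lab e = lab e') ∧
      ((((univ : Finset V).powersetCard 3) \ G0).card : ℝ) ≤ α / 3 * (Fintype.card V : ℝ) ^ 3 := by
  set N : ℝ := (Fintype.card V : ℝ) with hN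
  have hNpos : 0 < N := lt_of_lt_of_le (by positivity) hn
  set l : Finset V → Finset (Finset V) := labH 5 H cH with hl
  have hlH : ∀ f ∈ H, ∀ g ∈ H, cH f = cH g → 4 ≤ (f ∩ g).card → l f = l g :=
    fun f hf g hg hc h => labH_eq hH hf hg hc h
  set good : Finset V → Prop := fun e => (1 - ε) * ((Fintype.card V).choose 2 : ℝ) ≤ (degT 5 H e : ℝ) with hgood
  have hex : ∀ e : Finset V, ∃ b x, e.card = 3 → good e →
      (1 - 3 * Real.sqrt ε) * N ≤ ((Nb H cH l e b x).card : ℝ) := by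
    intro e
    by_cases h : e.card = 3 ∧ good e
    · obtain ⟨b, x, hbx⟩ := linkH 3 H cH l hH hlH e h.1 ε hε hε1 hn h.2
      exact ⟨b, x, fun _ _ => hbx⟩
    · exact ⟨true, ∅, fun h1 h2 => absurd ⟨h1, h2⟩ h⟩
  choose col lab hcl using hex
  set d : ℝ := 3 * Real.sqrt ε * N with hdd
  have hd0 : 0 ≤ d := by positivity
  have hstar : ∀ (S : Finset V) (b : Bool), ∃ x0, S.card = 2 →
      cnt (fun x => x ∉ S ∧ good (insert x S) ∧ col (insert x S) = b ∧ lab (insert x S) ≠ x0) ≤ 2 * d := by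
    intro S b
    by_cases hS : S.card = 2
    · obtain ⟨x0, h0⟩ := star 2 H cH l hlH good col lab d hd0 (fun e he hg => by
        have := hcl e he hg
        rw [hdd]; linarith) S hS b
      exact ⟨x0, fun _ => h0⟩
    · exact ⟨∅, fun h => absurd h hS⟩
  choose X hX using hstar
  refine ⟨((univ : Finset V).powersetCard 3).filter (fun e => good e ∧ ∀ x ∈ e, lab e = X (e.erase x) (col e)),
    col, lab, ?_, ?_, ?_, ?_, ?_⟩
  · intro e he
    exact (mem_powersetCard.1 (mem_filter.1 he).1).2
  · intro e he
    have he3 := (mem_powersetCard.1 (mem_filter.1 he).1).2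
    have h1 := hcl e he3 (mem_filter.1 he).2.1
    have h2 : 0 < ((Nb H cH l e (col e) (lab e)).card : ℝ) :=
      lt_of_lt_of_le (mul_pos (by linarith) hNpos) h1
    have h3 : 0 < (Nb H cH l e (col e) (lab e)).card := by exact_mod_cast h2
    obtain ⟨z, hz⟩ := card_pos.1 h3
    simp only [Nb, mem_filter, mem_univ, true_and] at hz
    obtain ⟨u, hu, hc, hlu⟩ := hz
    rw [← hlu, ← hc]
    exact tcOf_isTC (by simp [hu])
  · intro e he
    have he3 := (mem_powersetCard.1 (mem_filter.1 he).1).2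
    have h1 := hcl e he3 (mem_filter.1 he).2.1
    refine h1.trans ?_
    have h2 := deg_shadow 3 e he3 (lab e) (Nb H cH l e (col e) (lab e)) (by
      intro z hz
      simp only [Nb, mem_filter, mem_univ, true_and] at hz
      obtain ⟨u, hu, hc, hlu⟩ := hz
      constructor
      · intro hze
        have h4 := hH _ hu
        rw [insert_eq_of_mem hze] at h4
        have := card_insert_le u e
        omega
      · refine ⟨_, ?_, subset_insert u _⟩
        rw [← hlu]
        exact self_mem_tcOf (by simp [hu]))
    exact_mod_cast h2
  · intro e he e' he' hc hcard
    simp only [mem_filter, mem_powersetCard, subset_univ, true_and] at he he'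
    have key : ∀ a b : Finset V, a.card = 3 → (a ∩ b).card = 2 → ∃ x ∈ a, a.erase x = a ∩ b := by
      intro a b ha hab
      have h1 : (a \ b).card = 1 := by
        have := card_sdiff_add_card_inter a b
        omega
      obtain ⟨x, hx⟩ := card_eq_one.1 h1
      have hxa : x ∈ a \ b := by rw [hx]; simp
      rw [mem_sdiff] at hxa
      refine ⟨x, hxa.1, ?_⟩
      symm
      apply eq_of_subset_of_card_le
      · intro y hy
        rw [mem_inter] at hy
        rw [mem_erase]
        refine ⟨?_, hy.1⟩
        rintro rfl
        exact hxa.2 hy.2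
      · rw [card_erase_of_mem hxa.1]; omega
    obtain ⟨x, hx, hx2⟩ := key e e' he.1 hcard
    obtain ⟨y, hy, hy2⟩ := key e' e he'.1 (by rw [inter_comm]; exact hcard)
    rw [he.2.2 x hx, he'.2.2 y hy, hx2, hy2, hc, inter_comm]
  · set E : Finset V → Bool → Finset V := fun S b =>
      univ.filter (fun x => x ∉ S ∧ good (insert x S) ∧ col (insert x S) = b ∧ lab (insert x S) ≠ X S b) with hE
    set Bd : Finset (Finset V) := univ.filter (fun e => e.card = 3 ∧ ¬ good e) with hBd
    have hEc : ∀ S b, S.card = 2 → ((E S b).card : ℝ) ≤ 2 * d := by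
      intro S b hS
      refine le_trans ?_ (hX S b hS)
      apply le_cnt
      intro v hv
      exact (mem_filter.1 hv).2
    have hBc : (Bd.card : ℝ) ≤ α * ((Fintype.card V).choose 3 : ℝ) := by
      have h1 := (hd 3 (by norm_num) (by norm_num)).1
      have h2 : {S : Finset V | S.card = 3 ∧
        (degT 5 H S : ℝ) < (1 - ε) * ((Fintype.card V).choose (5 - 3))} = (Bd : Set (Finset V)) := by
        ext S
        simp [hBd, hgood]
      rw [h2, Set.ncard_coe_finset] at h1
      exact h1
    set F : Finset (Finset V) := ((univ : Finset V).powersetCard 2).biUnion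
      (fun S => (E S true ∪ E S false).image (fun x => insert x S)) with hF
    have hFc : (F.card : ℝ) ≤ ((Fintype.card V).choose 2 : ℝ) * (4 * d) := by
      have h1 : (F.card : ℝ) ≤ ∑ S ∈ (univ : Finset V).powersetCard 2,
          (((E S true ∪ E S false).image (fun x => insert x S)).card : ℝ) := by
        exact_mod_cast card_biUnion_le
      have h2 : ∑ S ∈ (univ : Finset V).powersetCard 2,
          (((E S true ∪ E S false).image (fun x => insert x S)).card : ℝ) ≤
          ∑ S ∈ (univ : Finset V).powersetCard 2, 4 * d := by
        apply sum_le_sum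
        intro S hS
        have hS2 := (mem_powersetCard.1 hS).2
        have h3 : ((E S true ∪ E S false).image (fun x => insert x S)).card ≤ (E S true).card + (E S false).card :=
          card_image_le.trans (card_union_le _ _)
        have h4 : (((E S true ∪ E S false).image (fun x => insert x S)).card : ℝ) ≤
          (E S true).card + (E S false).card := by exact_mod_cast h3
        have := hEc S true hS2
        have := hEc S false hS2
        linarith
      rw [sum_const, card_powersetCard, card_univ, nsmul_eq_mul] at h2
      exact h1.trans h2
    have hsub : ((univ : Finset V).powersetCard 3) \ (((univ : Finset V).powersetCard 3).filter
        (fun e => good e ∧ ∀ x ∈ e, lab e = X (e.erase x) (col e))) ⊆ Bd ∪ F := by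
      intro e he
      simp only [mem_sdiff, mem_filter, mem_powersetCard, subset_univ, true_and, not_and] at he
      obtain ⟨he3, hne⟩ := he
      rw [mem_union]
      by_cases hg : good e
      · right
        have h1 := hne he3 hg
        push Not at h1
        obtain ⟨x, hx, hxl⟩ := h1
        simp only [hF, mem_biUnion, mem_powersetCard, subset_univ, true_and, mem_image]
        refine ⟨e.erase x, by rw [card_erase_of_mem hx, he3], x, ?_, insert_erase hx⟩
        have h2 : x ∈ E (e.erase x) (col e) := by
          simp only [hE, mem_filter, mem_univ, true_and, insert_erase hx]
          exact ⟨by simp, hg, hxl⟩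
        rw [mem_union]
        rcases hb : col e with _ | _
        · right; rwa [hb] at h2
        · left; rwa [hb] at h2
      · left
        simp [hBd, he3, hg]
    have h1 := (card_le_card hsub).trans (card_union_le _ _)
    have h2 : ((((univ : Finset V).powersetCard 3) \ (((univ : Finset V).powersetCard 3).filter
        (fun e => good e ∧ ∀ x ∈ e, lab e = X (e.erase x) (col e)))).card : ℝ) ≤ Bd.card + F.card := by
      exact_mod_cast h1
    refine h2.trans ?_
    have h3 := choose_two_le (Fintype.card V)
    have h4 : ((Fintype.card V).choose 3 : ℝ) ≤ N ^ 3 / 6 := by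
      have := Nat.choose_le_pow_div (α := ℝ) 3 (Fintype.card V)
      simpa [Nat.factorial] using this
    have h5 : α * ((Fintype.card V).choose 3 : ℝ) ≤ α * (N ^ 3 / 6) := mul_le_mul_of_nonneg_left h4 hα.le
    have h6 : ((Fintype.card V).choose 2 : ℝ) * (4 * d) ≤ (N ^ 2 / 2) * (4 * d) :=
      mul_le_mul_of_nonneg_right h3 (by positivity)
    have h7 : (N ^ 2 / 2) * (4 * d) = 6 * N ^ 3 * Real.sqrt ε := by rw [hdd]; ring
    have h8 : 6 * N ^ 3 * Real.sqrt ε ≤ 6 * N ^ 3 * (α / 36) := mul_le_mul_of_nonneg_left hεα (by positivity)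
    linarith

theorem stage2 {V : Type*} [Fintype V] [DecidableEq V] {H : Finset (Finset V)} {cH : Finset V → Bool}
    {ε' : ℝ} (G : Blueprint 5 H cH ε') (γ : ℝ) (hγ : 0 < γ) (hγ1 : γ < 1 / 25)
    (hn : 4 / γ ≤ (Fintype.card V : ℝ)) (hs3 : 3 * Real.sqrt γ < 1)
    (hd : IsDense 3 G.edges (1 - γ) γ) :
    ∃ (A : Bool → Finset V) (R : Bool → Finset (Finset V)),
      Disjoint (A true) (A false) ∧
      (∀ b, IsTightComponent 5 (H.filter (fun f => cH f = b)) (R b)) ∧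
      (((univ : Finset V) \ (A true ∪ A false)).card : ℝ) ≤
        (γ + 12 * Real.sqrt γ) * (Fintype.card V : ℝ) ∧
      (∀ b, ∀ v ∈ A b, (1 - 3 * Real.sqrt γ) * (Fintype.card V : ℝ) ≤
        (degT 2 (shadowTo 2 (G.edges.filter (fun e => G.comp e = R b))) {v} : ℝ)) := by
  set N : ℝ := (Fintype.card V : ℝ) with hN
  have hNpos : 0 < N := lt_of_lt_of_le (by positivity) hn
  have hG : ∀ f ∈ G.edges, f.card = 3 := fun f hf => G.edges_card f hf
  have hl : ∀ f ∈ G.edges, ∀ g ∈ G.edges, G.col f = G.col g → 2 ≤ (f ∩ g).card → G.comp f = G.comp g := by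
    intro f hf g hg hc h
    by_cases h2 : (f ∩ g).card = 2
    · exact G.comp_agree f hf g hg hc h2
    · have h1 : f ∩ g = f := eq_of_subset_of_card_le inter_subset_left (by rw [hG f hf]; omega)
      have h2 : f ∩ g = g := eq_of_subset_of_card_le inter_subset_right (by rw [hG g hg]; omega)
      rw [h1.symm.trans h2]
  set good : Finset V → Prop := fun e => (1 - γ) * ((Fintype.card V).choose 2 : ℝ) ≤ (degT 3 G.edges e : ℝ) with hgood
  have hex : ∀ e : Finset V, ∃ b x, e.card = 1 → good e →
      (1 - 3 * Real.sqrt γ) * N ≤ ((Nb G.edges G.col G.comp e b x).card : ℝ) := by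
    intro e
    by_cases h : e.card = 1 ∧ good e
    · obtain ⟨b, x, hbx⟩ := linkH 1 G.edges G.col G.comp hG hl e h.1 γ hγ hγ1 hn h.2
      exact ⟨b, x, fun _ _ => hbx⟩
    · exact ⟨true, ∅, fun h1 h2 => absurd ⟨h1, h2⟩ h⟩
  choose col lab hcl using hex
  set d : ℝ := 3 * Real.sqrt γ * N with hdd
  have hd0 : 0 ≤ d := by positivity
  have hstar : ∀ b : Bool, ∃ x0,
      cnt (fun x => good {x} ∧ col {x} = b ∧ lab {x} ≠ x0) ≤ 2 * d := by
    intro b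
    obtain ⟨x0, h0⟩ := star 0 G.edges G.col G.comp hl good col lab d hd0 (fun e he hg => by
        have := hcl e he hg
        rw [hdd]; linarith) ∅ rfl b
    refine ⟨x0, le_trans (cnt_mono ?_) h0⟩
    intro v hv
    exact ⟨by simp, hv⟩
  choose X hX using hstar
  set A : Bool → Finset V := fun b => univ.filter (fun v => good {v} ∧ col {v} = b ∧ lab {v} = X b) with hA
  have hAmem : ∀ b v, v ∈ A b ↔ good {v} ∧ col {v} = b ∧ lab {v} = X b := by
    intro b v; simp [hA]
  have hcompX : ∀ b, (A b).Nonempty → IsTightComponent 5 (H.filter (fun f => cH f = b)) (X b) := by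
    rintro b ⟨v, hv⟩
    rw [hAmem] at hv
    have h1 := hcl {v} (by simp) hv.1
    have h2 : 0 < ((Nb G.edges G.col G.comp {v} (col {v}) (lab {v})).card : ℝ) :=
      lt_of_lt_of_le (mul_pos (by linarith) hNpos) h1
    have h3 : 0 < (Nb G.edges G.col G.comp {v} (col {v}) (lab {v})).card := by exact_mod_cast h2
    obtain ⟨z, hz⟩ := card_pos.1 h3
    simp only [Nb, mem_filter, mem_univ, true_and] at hz
    obtain ⟨u, hu, hc, hlu⟩ := hz
    have h4 := G.comp_is _ hu
    rw [hlu, hc, hv.2.1, hv.2.2] at h4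
    exact h4
  have hR : ∀ b, ∃ R, IsTightComponent 5 (H.filter (fun f => cH f = b)) R ∧ ((A b).Nonempty → R = X b) := by
    intro b
    by_cases h : (A b).Nonempty
    · exact ⟨X b, hcompX b h, fun _ => rfl⟩
    · obtain ⟨C, hC⟩ := exists_tc 5 (H.filter (fun f => cH f = b))
      exact ⟨C, hC, fun h' => absurd h' h⟩
  choose R hR1 hR2 using hR
  refine ⟨A, R, ?_, hR1, ?_, ?_⟩
  · rw [disjoint_left]
    intro v h1 h2
    rw [hAmem] at h1 h2
    have := h1.2.1.symm.trans h2.2.1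
    exact absurd this (by simp)
  · have hbad : cnt (fun v => ¬ good {v}) ≤ γ * N := by
      have h1 := (hd 1 (by norm_num) (by norm_num)).1
      rw [Nat.choose_one_right] at h1
      refine le_trans ?_ h1
      have h2 : (((univ.filter (fun v => ¬ good {v})).image (fun v => ({v} : Finset V)) : Finset (Finset V)) : Set (Finset V)) ⊆
        {S : Finset V | S.card = 1 ∧
          (degT 3 G.edges S : ℝ) < (1 - γ) * ((Fintype.card V).choose (3 - 1))} := by
        intro S hS
        simp only [coe_image, coe_filter, mem_univ, true_and, Set.mem_image] at hS
        obtain ⟨v, hv, rfl⟩ := hS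
        exact ⟨by simp, not_le.1 hv⟩
      have h3 := Set.ncard_le_ncard h2 (Set.toFinite _)
      rw [Set.ncard_coe_finset, card_image_of_injective _ singleton_injective] at h3
      rw [← card_eq_cnt (univ.filter (fun v => ¬ good {v})) (by simp)]
      exact_mod_cast h3
    have h1 := le_cnt (p := fun v => ¬ good {v} ∨ ((good {v} ∧ col {v} = true ∧ lab {v} ≠ X true) ∨
        (good {v} ∧ col {v} = false ∧ lab {v} ≠ X false))) ((univ : Finset V) \ (A true ∪ A false)) (by
      intro v hv
      simp only [mem_sdiff, mem_univ, true_and, mem_union, hAmem] at hv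
      by_cases hg : good {v}
      · right
        rcases hb : col {v} with _ | _
        · right
          refine ⟨hg, rfl, ?_⟩
          intro h
          exact hv (Or.inr ⟨hg, hb, h⟩)
        · left
          refine ⟨hg, rfl, ?_⟩
          intro h
          exact hv (Or.inl ⟨hg, hb, h⟩)
      · exact Or.inl hg)
    have h2 := cnt_or (p := fun v => ¬ good {v} ∨ ((good {v} ∧ col {v} = true ∧ lab {v} ≠ X true) ∨
        (good {v} ∧ col {v} = false ∧ lab {v} ≠ X false))) _ _ (fun v h => h)
    have h3 := cnt_or (p := fun v => ((good {v} ∧ col {v} = true ∧ lab {v} ≠ X true) ∨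
        (good {v} ∧ col {v} = false ∧ lab {v} ≠ X false))) _ _ (fun v h => h)
    have h4 := hX true
    have h5 := hX false
    have h6 : 4 * d = 12 * Real.sqrt γ * N := by rw [hdd]; ring
    linarith
  · intro b v hv
    rw [hR2 b ⟨v, hv⟩]
    rw [hAmem] at hv
    have h1 := hcl {v} (by simp) hv.1
    refine h1.trans ?_
    have h2 := deg_shadow 1 {v} (by simp) (G.edges.filter (fun e => G.comp e = X b))
      (Nb G.edges G.col G.comp {v} (col {v}) (lab {v})) (by
      intro z hz
      simp only [Nb, mem_filter, mem_univ, true_and] at hz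
      obtain ⟨u, hu, hc, hlu⟩ := hz
      constructor
      · intro hze
        have h4 := hG _ hu
        rw [insert_eq_of_mem hze] at h4
        have := card_insert_le u {v}
        rw [card_singleton] at this
        omega
      · refine ⟨_, ?_, subset_insert u _⟩
        rw [mem_filter]
        exact ⟨hu, hlu.trans hv.2.2⟩)
    exact_mod_cast h2

theorem params (α : ℝ) (hα : 0 < α) (h : α ≤ (1 / 20 : ℝ) ^ (5550 : ℝ)) :
    ∃ s : ℝ, 0 < s ∧ s ≤ 1 / 20 ∧ α ≤ s ^ 6 * s ^ 600 ∧ α ^ ((1 : ℝ) / 37) = s ^ 150 ∧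
      α ^ ((1 : ℝ) / 75) = s ^ 74 := by
  have hs1 : α ^ ((1 : ℝ) / 5550) ≤ 1 / 20 := by
    have h1 := Real.rpow_le_rpow hα.le h (show (0 : ℝ) ≤ 1 / 5550 by norm_num)
    rw [← Real.rpow_mul (by norm_num)] at h1
    rwa [show (5550 : ℝ) * (1 / 5550) = 1 by norm_num, Real.rpow_one] at h1
  have hpos : 0 < α ^ ((1 : ℝ) / 5550) := Real.rpow_pos_of_pos hα _
  have hα1 : α ≤ 1 := h.trans (Real.rpow_le_one (by norm_num) (by norm_num) (by norm_num))
  refine ⟨α ^ ((1 : ℝ) / 5550), hpos, hs1, ?_, ?_, ?_⟩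
  · rw [← pow_add, ← Real.rpow_natCast, ← Real.rpow_mul hα.le]
    calc α = α ^ (1 : ℝ) := (Real.rpow_one α).symm
      _ ≤ _ := Real.rpow_le_rpow_of_exponent_ge hα hα1 (by norm_num)
  · rw [← Real.rpow_natCast, ← Real.rpow_mul hα.le]
    norm_num
  · rw [← Real.rpow_natCast, ← Real.rpow_mul hα.le]
    norm_num

end main

/-- Lemma 7.2 of the paper: for suitable `0 < ε ≪ α` and large `n`, every 2-edge-coloured
`(1-ε, α)`-dense 5-graph `H` on `n` vertices admits a `3√ε`-blueprint `G` with
`V(G) = V(H)`, disjoint sets `Vred, Vblue` of vertices, a red tight component `Rs` and a blue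
tight component `Bs` of `H` such that: (i) `G`, as a 3-graph on `n` vertices, is
`(1 - α^{1/37}, α^{1/37})`-dense; (ii) `|V(H) ∖ (Vred ∪ Vblue)| ≤ α^{1/75} n`;
(iii) `d_{∂(R³)}(v) ≥ (1 - α^{1/75})n` for all `v ∈ Vred`, where `R³` is the 3-graph of all
edges of `G` inducing `Rs`; (iv) the analogous statement for blue. -/
theorem stmt19 :
    ∃ α₀ : ℝ, 0 < α₀ ∧ ∀ α : ℝ, 0 < α → α ≤ α₀ →
      ∃ ε₀ : ℝ, 0 < ε₀ ∧ ∀ ε : ℝ, 0 < ε → ε ≤ ε₀ →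
        ∃ n₀ : ℕ, ∀ n : ℕ, n₀ ≤ n →
          ∀ (H : Finset (Finset (Fin n))) (cH : Finset (Fin n) → Bool),
            (∀ e ∈ H, e.card = 5) → IsDense 5 H (1 - ε) α →
            ∃ (G : Blueprint 5 H cH (3 * Real.sqrt ε)) (Vred Vblue : Finset (Fin n))
              (Rs Bs : Finset (Finset (Fin n))),
              G.verts = Finset.univ ∧
              Disjoint Vred Vblue ∧
              IsTightComponent 5 (H.filter (fun f => cH f = true)) Rs ∧
              IsTightComponent 5 (H.filter (fun f => cH f = false)) Bs ∧
              IsDense 3 G.edges (1 - α ^ ((1 : ℝ) / 37)) (α ^ ((1 : ℝ) / 37)) ∧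
              (((Finset.univ : Finset (Fin n)) \ (Vred ∪ Vblue)).card : ℝ) ≤
                α ^ ((1 : ℝ) / 75) * n ∧
              (∀ v ∈ Vred,
                (1 - α ^ ((1 : ℝ) / 75)) * n ≤
                  (degT 2 (shadowTo 2 (G.edges.filter (fun e => G.comp e = Rs))) {v} : ℝ)) ∧
              (∀ v ∈ Vblue,
                (1 - α ^ ((1 : ℝ) / 75)) * n ≤
                  (degT 2 (shadowTo 2 (G.edges.filter (fun e => G.comp e = Bs))) {v} : ℝ)) := by
  refine ⟨(1 / 20 : ℝ) ^ (5550 : ℝ), by positivity, ?_⟩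
  intro α hα hα0
  obtain ⟨s, hs, hs1, hsα, hs37, hs75⟩ := params α hα hα0
  rw [hs37, hs75]
  have hα1 : α ≤ 1 := hα0.trans (Real.rpow_le_one (by norm_num) (by norm_num) (by norm_num))
  have hp : ∀ k : ℕ, 0 < s ^ k := fun k => pow_pos hs k
  have hs75' : s ^ 75 = s * s ^ 74 := by ring
  have hs74 : s ^ 74 ≤ 1 / 20 := by
    calc s ^ 74 ≤ s ^ 1 := pow_le_pow_of_le_one hs.le (by linarith) (by norm_num)
      _ ≤ 1 / 20 := by simpa using hs1
  have hs75le : s ^ 75 ≤ 1 / 20 * s ^ 74 := by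
    rw [hs75']; exact mul_le_mul_of_nonneg_right hs1 (hp 74).le
  have hs150 : s ^ 150 = s ^ 75 * s ^ 75 := by ring
  have hsq : Real.sqrt (s ^ 150) = s ^ 75 := by
    rw [hs150]; exact Real.sqrt_mul_self (hp 75).le
  have hs75s : s ^ 75 ≤ 1 / 400 := by linarith
  have hs150le : s ^ 150 ≤ 1 / 400 * s ^ 75 := by
    rw [hs150]; exact mul_le_mul_of_nonneg_right hs75s (hp 75).le
  refine ⟨(α / 36) ^ 2, by positivity, ?_⟩
  intro ε hε hε0
  have hsqε : Real.sqrt ε ≤ α / 36 := by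
    have := Real.sqrt_le_sqrt hε0
    rwa [Real.sqrt_sq (by positivity)] at this
  have hε1 : ε < 1 / 25 := by nlinarith
  refine ⟨⌈4 / ε⌉₊ + ⌈4 / s ^ 150⌉₊ + ⌈3 / α⌉₊ + 2, ?_⟩
  intro n hn H cH hH hd
  have hn1 : 4 / ε ≤ (Fintype.card (Fin n) : ℝ) := by
    rw [Fintype.card_fin]
    exact (Nat.le_ceil _).trans (by exact_mod_cast (by omega))
  have hn2 : 4 / s ^ 150 ≤ (Fintype.card (Fin n) : ℝ) := by
    rw [Fintype.card_fin]
    exact (Nat.le_ceil _).trans (by exact_mod_cast (by omega))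
  have hn3 : 3 / α ≤ (Fintype.card (Fin n) : ℝ) := by
    rw [Fintype.card_fin]
    exact (Nat.le_ceil _).trans (by exact_mod_cast (by omega))
  have hn4 : 2 ≤ Fintype.card (Fin n) := by
    rw [Fintype.card_fin]; omega
  obtain ⟨G0, col, lab, g1, g2, g3, g4, g5⟩ := stage1 H cH hH ε α hε hε1 hα hsqε hn1 (by linarith) hd
  have hord := ordered G0
  obtain ⟨G, hGsub, hGd⟩ := clean G0 (s ^ 150) (hp 150) (by linarith) hn4 (by
    refine hord.trans ?_
    set N : ℝ := (Fintype.card (Fin n) : ℝ) with hN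
    have hNpos : 0 < N := lt_of_lt_of_le (by positivity) hn3
    have h1 : 3 * N ^ 2 ≤ α * N ^ 3 := by
      rw [div_le_iff₀ hα] at hn3
      have : 3 * N ^ 2 ≤ (N * α) * N ^ 2 := mul_le_mul_of_nonneg_right hn3 (by positivity)
      calc 3 * N ^ 2 ≤ (N * α) * N ^ 2 := this
        _ = α * N ^ 3 := by ring
    have h6 : s ^ 6 ≤ (1 / 20) ^ 6 := pow_le_pow_left₀ hs.le hs1 6
    have h2 : 10 * α ≤ (s ^ 150 / 30) ^ 4 := by
      have h7 : s ^ 6 * s ^ 600 ≤ (1 / 20) ^ 6 * s ^ 600 := mul_le_mul_of_nonneg_right h6 (hp 600).le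
      have h8 : (s ^ 150 / 30) ^ 4 = s ^ 600 / 810000 := by
        rw [div_pow, ← pow_mul]; norm_num
      rw [h8]
      have := hp 600
      norm_num at h7
      linarith
    have h3 : 10 * α * N ^ 3 ≤ (s ^ 150 / 30) ^ 4 * N ^ 3 := mul_le_mul_of_nonneg_right h2 (by positivity)
    linarith)
  let BP : Blueprint 5 H cH (3 * Real.sqrt ε) :=
    { verts := Finset.univ
      edges := G
      col := col
      comp := lab
      edges_card := fun e he => g1 e (hGsub he)
      edges_sub := fun e _ => Finset.subset_univ e
      comp_is := fun e he => g2 e (hGsub he)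
      comp_deg := fun e he => g3 e (hGsub he)
      comp_agree := fun e he e' he' => g4 e (hGsub he) e' (hGsub he') }
  obtain ⟨A, R, a1, a2, a3, a4⟩ := stage2 BP (s ^ 150) (hp 150) (by linarith) hn2
    (by rw [hsq]; linarith) hGd
  rw [hsq] at a3 a4
  rw [Fintype.card_fin] at a3 a4
  have hnn : (0 : ℝ) ≤ n := Nat.cast_nonneg n
  refine ⟨BP, A true, A false, R true, R false, rfl, a1, a2 true, a2 false, hGd, ?_, ?_, ?_⟩
  · exact a3.trans (mul_le_mul_of_nonneg_right (by linarith [hp 75, hp 74]) hnn)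
  · intro v hv
    exact (mul_le_mul_of_nonneg_right (by linarith [hp 74]) hnn).trans (a4 true v hv)
  · intro v hv
    exact (mul_le_mul_of_nonneg_right (by linarith [hp 74]) hnn).trans (a4 false v hv)
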